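/- (Theorem 1, min bound.) Let f : ℝ^n → ℝ be a differentiable convex function whose gradient is H-Lipschitz (H > 0), let 0 < η < 2/H, and let w_{t+1} = w_t - η·∇f(w_t) be the gradient-descent sequence from w_0. If w* satisfies f(w*) ≤ f(w_t) for every t, then for every T ≥ 1, min over t ∈ {0, …, T-1} of ‖∇f(w_t)‖² is at most (2/(η(2 - H·η)·T)) · (f(w_0) - f(w*)). -/

import Mathlib

/-- The quadratic upper bound for a differentiable function with `H`-Lipschitz gradient. -/
theorem le_add_inner_gradient_add_sq_of_lipschitz_gradient
    {E : Type*} [NormedAddCommGroup E] [InnerProductSpace ℝ E] [CompleteSpace E]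
    {f : E → ℝ} (hdiff : Differentiable ℝ f) {H : ℝ}
    (hlip : ∀ x y, ‖gradient f x - gradient f y‖ ≤ H * ‖x - y‖) (x v : E) :
    f (x + v) ≤ f x + inner ℝ (gradient f x) v + H / 2 * ‖v‖ ^ 2 := by
  have hline (s : ℝ) : HasDerivAt (fun s : ℝ => f (x + s • v))
      (inner ℝ (gradient f (x + s • v)) v) s := by
    have hv : HasDerivAt (fun s : ℝ => x + s • v) v s := by
      simpa using ((hasDerivAt_id s).smul_const v).const_add x
    exact (hdiff (x + s • v)).hasGradientAt.hasFDerivAt.comp_hasDerivAt s hv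
  have hquad (s : ℝ) : HasDerivAt
      (fun s : ℝ => f x + s * inner ℝ (gradient f x) v + H / 2 * ‖v‖ ^ 2 * s ^ 2)
      (inner ℝ (gradient f x) v + H * ‖v‖ ^ 2 * s) s := by
    refine ((((hasDerivAt_id s).mul_const (inner ℝ (gradient f x) v)).const_add (f x)).add
      ((hasDerivAt_pow 2 s).const_mul (H / 2 * ‖v‖ ^ 2))).congr_deriv ?_
    push_cast
    ring
  have key := image_le_of_deriv_right_le_deriv_boundary (a := 0) (b := 1)
    (fun s _ => (hline s).continuousAt.continuousWithinAt)
    (fun s _ => (hline s).hasDerivWithinAt) (by simp)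
    (fun s _ => (hquad s).continuousAt.continuousWithinAt)
    (fun s _ => (hquad s).hasDerivWithinAt)
    (fun s hs => by
      have hg : ‖gradient f (x + s • v) - gradient f x‖ ≤ H * (s * ‖v‖) := by
        simpa [norm_smul, abs_of_nonneg hs.1] using hlip (x + s • v) x
      have hi := real_inner_le_norm (gradient f (x + s • v) - gradient f x) v
      rw [inner_sub_left] at hi
      nlinarith [mul_le_mul_of_nonneg_right hg (norm_nonneg v)])
    (Set.right_mem_Icc.mpr zero_le_one)
  simpa using key

/-- Theorem 1 (min bound): along gradient descent with step `0 < η < 2/H` on a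
differentiable convex function with `H`-Lipschitz gradient, if `f(w*) ≤ f(w_t)`
for all `t`, then `min_{t < T} ‖∇f(w_t)‖² ≤ (2/(η(2 - Hη)T)) (f(w_0) - f(w*))`. -/
theorem gradient_descent_min_sq_norm_le
    (n : ℕ) (f : EuclideanSpace ℝ (Fin n) → ℝ)
    (hdiff : Differentiable ℝ f)
    (hconv : ConvexOn ℝ Set.univ f)
    (H : ℝ) (hH : 0 < H)
    (hlip : ∀ x y, ‖gradient f x - gradient f y‖ ≤ H * ‖x - y‖)
    (η : ℝ) (hη₀ : 0 < η) (hη₁ : η < 2 / H)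
    (w : ℕ → EuclideanSpace ℝ (Fin n))
    (hw : ∀ t, w (t + 1) = w t - η • gradient f (w t))
    (wstar : EuclideanSpace ℝ (Fin n))
    (hstar : ∀ t, f wstar ≤ f (w t))
    (T : ℕ) (hT : 1 ≤ T) :
    (Finset.range T).inf' (Finset.nonempty_range_iff.mpr (by omega))
        (fun t => ‖gradient f (w t)‖ ^ 2)
      ≤ 2 / (η * (2 - H * η) * T) * (f (w 0) - f wstar) := by
  have hstep (t : ℕ) : η * (2 - H * η) / 2 * ‖gradient f (w t)‖ ^ 2 ≤ f (w t) - f (w (t + 1)) := by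
    have h := le_add_inner_gradient_add_sq_of_lipschitz_gradient hdiff hlip (w t)
      (-(η • gradient f (w t)))
    rw [← sub_eq_add_neg, ← hw, inner_neg_right, real_inner_smul_right,
      real_inner_self_eq_norm_sq, norm_neg, norm_smul, mul_pow, Real.norm_eq_abs, sq_abs] at h
    linarith
  have hc : 0 < η * (2 - H * η) := by
    rw [lt_div_iff₀ hH] at hη₁
    exact mul_pos hη₀ (by linarith)
  have hT₀ : (0 : ℝ) < T := by exact_mod_cast hT
  set m := (Finset.range T).inf' (Finset.nonempty_range_iff.mpr (by omega))
    (fun t => ‖gradient f (w t)‖ ^ 2)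
  have hsum : T * (η * (2 - H * η) / 2 * m) ≤ f (w 0) - f (w T) := by
    rw [← Finset.sum_range_sub' (fun t => f (w t)), ← nsmul_eq_mul]
    nth_rewrite 1 [← Finset.card_range T]
    refine Finset.card_nsmul_le_sum _ _ _ fun t ht => le_trans ?_ (hstep t)
    exact mul_le_mul_of_nonneg_left (Finset.inf'_le _ ht) (by positivity)
  rw [div_mul_eq_mul_div, le_div_iff₀ (mul_pos hc hT₀)]
  linarith [hstar T]
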